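/- Let S = {(x,y,z) ∈ ℤ³ : 0 ≤ y ≤ x and 0 ≤ z ≤ x} and JMon = {a ∈ S : h_i(a) > 0 for all i = 1,2,3,4}. For every d ∈ ℤ³, the vanishing ideal in ℂ[θ₁,θ₂,θ₃] of the set Ω(d) ∪ {a ∈ JMon : a + d ∉ JMon} is the principal ideal generated by ∏_{i ∈ {1,2,3,4} with h_i(d) < 0} (H_i, h_i(−d))!, where the product is over those indices i with h_i(d) < 0 and an empty product is 1. (This computes all graded pieces of the idealizer II(J) for J = ⟨t₁²t₂t₃⟩.) -/

import Mathlib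

open MvPolynomial

noncomputable section

/-- The polynomial ring ℂ[θ₁, θ₂, θ₃]. -/
abbrev Cθ3 : Type := MvPolynomial (Fin 3) ℂ

/-- The vanishing ideal of a set `V ⊆ ℤ³` inside ℂ[θ₁, θ₂, θ₃]. -/
def vanishingIdeal (V : Set (ℤ × ℤ × ℤ)) : Ideal Cθ3 where
  carrier := {f | ∀ a ∈ V, eval ![(a.1 : ℂ), (a.2.1 : ℂ), (a.2.2 : ℂ)] f = 0}
  add_mem' := by
    intro f g hf hg a ha
    simp [map_add, hf a ha, hg a ha]
  zero_mem' := by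
    intro a _
    simp
  smul_mem' := by
    intro c f hf a ha
    simp [smul_eq_mul, hf a ha]

/-- The descending factorial `(P, m)! = ∏_{j=0}^{m} (P - j)`, equal to `1` when `m < 0`. -/
def dfact (P : Cθ3) (m : ℤ) : Cθ3 :=
  ∏ j ∈ Finset.range (m + 1).toNat, (P - C (j : ℂ))

/-- `S = {(x, y, z) ∈ ℤ³ : 0 ≤ y ≤ x and 0 ≤ z ≤ x}`, the exponent set of the normal
affine semigroup ring `R_A = ℂ[t₁, t₁t₂, t₁t₃, t₁t₂t₃]`. -/
def Sset3 : Set (ℤ × ℤ × ℤ) :=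
  {a | 0 ≤ a.2.1 ∧ a.2.1 ≤ a.1 ∧ 0 ≤ a.2.2 ∧ a.2.2 ≤ a.1}

/-- `JMon = {a ∈ S : h_i(a) > 0 for i = 1, 2, 3, 4}`, the exponents of monomials of the
interior ideal `J = ⟨t₁²t₂t₃⟩`, where `h₁(a) = a₃`, `h₂(a) = a₂`, `h₃(a) = a₁ − a₃`,
`h₄(a) = a₁ − a₂`. -/
def JMon3 : Set (ℤ × ℤ × ℤ) :=
  {a | a ∈ Sset3 ∧ 0 < a.2.2 ∧ 0 < a.2.1 ∧ 0 < a.1 - a.2.2 ∧ 0 < a.1 - a.2.1}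

/-- `Ω(d) = {a ∈ S : a + d ∉ S}`. -/
def Omega3 (d : ℤ × ℤ × ℤ) : Set (ℤ × ℤ × ℤ) := {a | a ∈ Sset3 ∧ a + d ∉ Sset3}

/-- The facet forms `H₁, …, H₄` of the cone as polynomials. -/
def facetForm : Fin 4 → Cθ3 := ![X 2, X 1, X 0 - X 2, X 0 - X 1]

/-- The integral support functions `h₁, …, h₄`. -/
def facetHeight (i : Fin 4) (a : ℤ × ℤ × ℤ) : ℤ :=
  ![a.2.2, a.2.1, a.1 - a.2.2, a.1 - a.2.1] i

/-- A parametrization of the lattice points on the plane `hᵢ = j`. -/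
def facetPoint (i : Fin 4) (j u v : ℤ) : ℤ × ℤ × ℤ :=
  ![(u + v, u, j), (u + v, j, u), (u + v + j, u, u + v), (u + v + j, u + v, u)] i

/-- The polynomial version of `facetPoint`, with parameters `X 0` and `X 1`. -/
def facetParam (i : Fin 4) (c : ℂ) : Fin 3 → Cθ3 :=
  ![![X 0 + X 1, X 0, C c], ![X 0 + X 1, C c, X 0],
    ![X 0 + X 1 + C c, X 0, X 0 + X 1], ![X 0 + X 1 + C c, X 0 + X 1, X 0]] i

/-- The coordinates on the plane `Hᵢ = c` recovering the parameters of `facetParam`. -/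
def facetCoord : Fin 4 → Fin 3 → Cθ3 :=
  ![![X 1, X 0 - X 1, 0], ![X 2, X 0 - X 2, 0], ![X 1, X 2 - X 1, 0], ![X 2, X 1 - X 2, 0]]

lemma facetHeight_add (i : Fin 4) (a d : ℤ × ℤ × ℤ) :
    facetHeight i (a + d) = facetHeight i a + facetHeight i d := by
  fin_cases i <;> simp [facetHeight] <;> ring

lemma eval_facetForm (i : Fin 4) (a : ℤ × ℤ × ℤ) :
    eval ![(a.1 : ℂ), (a.2.1 : ℂ), (a.2.2 : ℂ)] (facetForm i) = (facetHeight i a : ℂ) := by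
  fin_cases i <;> simp [facetForm, facetHeight]

lemma mem_Sset3_iff {a : ℤ × ℤ × ℤ} : a ∈ Sset3 ↔ ∀ i, 0 ≤ facetHeight i a := by
  simp only [Sset3, Set.mem_ofPred_eq, facetHeight, Fin.forall_fin_succ]
  simp
  tauto

lemma mem_JMon3_iff {a : ℤ × ℤ × ℤ} : a ∈ JMon3 ↔ ∀ i, 0 < facetHeight i a := by
  simp only [JMon3, Sset3, Set.mem_ofPred_eq, facetHeight, Fin.forall_fin_succ]
  simp
  omega

lemma facetHeight_facetPoint_self (i : Fin 4) (j u v : ℤ) :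
    facetHeight i (facetPoint i j u v) = j := by
  fin_cases i <;> simp [facetHeight, facetPoint]

lemma lt_facetHeight_facetPoint {i k : Fin 4} (hik : i ≠ k) {j b u v : ℤ} (hj : 0 ≤ j)
    (hb : 0 ≤ b) (hu : j + b < u) (hv : j + b < v) :
    b < facetHeight k (facetPoint i j u v) := by
  fin_cases i <;> fin_cases k <;> simp [facetHeight, facetPoint] at hik ⊢ <;> omega

lemma eval_facetParam (i : Fin 4) (j : ℤ) (x : Fin 3 → ℂ) {u v : ℤ} (hu : x 0 = u)
    (hv : x 1 = v) :
    (fun k => eval x (facetParam i j k)) =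
      ![((facetPoint i j u v).1 : ℂ), ((facetPoint i j u v).2.1 : ℂ),
        ((facetPoint i j u v).2.2 : ℂ)] := by
  funext k
  fin_cases i <;> fin_cases k <;> simp [facetParam, facetPoint, hu, hv]

lemma bind₁_facetParam_facetForm (i : Fin 4) (c : ℂ) :
    bind₁ (facetParam i c) (facetForm i - C c) = 0 := by
  fin_cases i <;> simp [facetParam, facetForm]

lemma facetForm_dvd_X_sub (i : Fin 4) (c : ℂ) (k : Fin 3) :
    facetForm i - C c ∣ X k - bind₁ (facetCoord i) (facetParam i c k) := by
  fin_cases i <;> fin_cases k <;> simp [facetForm, facetParam, facetCoord]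
  all_goals exact dvd_of_eq (by ring)

/-- If `L` divides every `X k - φ k`, then it divides `f - f(φ)`. -/
lemma dvd_sub_bind₁ {σ R : Type*} [CommRing R] {L : MvPolynomial σ R}
    {φ : σ → MvPolynomial σ R} (h : ∀ k, L ∣ X k - φ k) (f : MvPolynomial σ R) :
    L ∣ f - bind₁ φ f := by
  simp only [← Ideal.mem_span_singleton, ← Ideal.Quotient.mk_eq_mk_iff_sub_mem] at h ⊢
  have key : (Ideal.Quotient.mkₐ R (Ideal.span {L})) =
      (Ideal.Quotient.mkₐ R (Ideal.span {L})).comp (bind₁ φ) := by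
    ext k
    simpa using h k
  exact DFunLike.congr_fun key f

lemma facetForm_sub_C_dvd_iff (i : Fin 4) (c : ℂ) (f : Cθ3) :
    facetForm i - C c ∣ f ↔ bind₁ (facetParam i c) f = 0 := by
  constructor
  · rintro ⟨g, rfl⟩
    rw [map_mul, bind₁_facetParam_facetForm, zero_mul]
  · intro h
    have := dvd_sub_bind₁ (facetForm_dvd_X_sub i c) f
    rwa [← bind₁_bind₁, h, map_zero, sub_zero] at this

lemma prime_facetForm_sub_C (i : Fin 4) (c : ℂ) : Prime (facetForm i - C c) := by
  refine ⟨fun h => ?_, fun h => ?_, fun f g h => ?_⟩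
  · have := congrArg (eval ![c + 2, 1, 1]) h
    have h' := congrArg (eval ![c + 1, c + 1, c + 1]) h
    fin_cases i <;> simp [facetForm] at this h' <;> grind
  · have := h.map (bind₁ (facetParam i c))
    rw [bind₁_facetParam_facetForm] at this
    exact not_isUnit_zero this
  · simpa [facetForm_sub_C_dvd_iff] using h

lemma facetForm_sub_C_dvd_of_eval_eq_zero (i : Fin 4) (j : ℤ) (f : Cθ3)
    (h : ∀ u v : ℤ, j < u → j < v →
      eval ![((facetPoint i j u v).1 : ℂ), ((facetPoint i j u v).2.1 : ℂ),
        ((facetPoint i j u v).2.2 : ℂ)] f = 0) :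
    facetForm i - C (j : ℂ) ∣ f := by
  rw [facetForm_sub_C_dvd_iff]
  refine funext_set (fun _ => (fun n : ℤ => (n : ℂ)) '' Set.Ioi j) (fun _ => ?_) fun x hx => ?_
  · exact (Set.Ioi_infinite j).image Int.cast_injective.injOn
  · obtain ⟨u, hu, hu'⟩ := hx 0 trivial
    obtain ⟨v, hv, hv'⟩ := hx 1 trivial
    rw [map_zero, ← h u v hu hv, ← eval_facetParam i j x hu'.symm hv'.symm]
    exact eval₂Hom_bind₁ _ _ _ _

lemma isRelPrime_facetForm_sub_C {i k : Fin 4} {j b : ℕ} (h : (i, j) ≠ (k, b)) :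
    IsRelPrime (facetForm i - C (j : ℂ)) (facetForm k - C (b : ℂ)) := by
  rw [(prime_facetForm_sub_C i j).irreducible.isRelPrime_iff_not_dvd]
  rintro ⟨g, hg⟩
  have hev := congrArg (eval ![((facetPoint i j (j + b + 1) (j + b + 1)).1 : ℂ),
    ((facetPoint i j (j + b + 1) (j + b + 1)).2.1 : ℂ),
    ((facetPoint i j (j + b + 1) (j + b + 1)).2.2 : ℂ)]) hg
  rw [map_mul, map_sub, map_sub, eval_facetForm, eval_facetForm,
    facetHeight_facetPoint_self, eval_C, eval_C, Int.cast_natCast, sub_self, zero_mul,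
    sub_eq_zero] at hev
  replace hev := Int.cast_injective (hev.trans (Int.cast_natCast b).symm)
  by_cases hik : i = k
  · subst hik
    rw [facetHeight_facetPoint_self] at hev
    exact h (by simpa using hev)
  · have := lt_facetHeight_facetPoint hik (j := j) (b := b) (u := j + b + 1) (v := j + b + 1)
      (by omega) (by omega) (by omega) (by omega)
    exact this.ne' hev

/-- The points of `Ω(d) ∪ {a ∈ JMon : a + d ∉ JMon}` lie on the planes `hᵢ = j` with
`0 ≤ j ≤ -hᵢ(d)` and `hᵢ(d) < 0`. -/
lemma exists_facetHeight_of_mem {d a : ℤ × ℤ × ℤ}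
    (ha : a ∈ Omega3 d ∪ {a | a ∈ JMon3 ∧ a + d ∉ JMon3}) :
    ∃ i, facetHeight i d < 0 ∧ 0 ≤ facetHeight i a ∧ facetHeight i a ≤ -facetHeight i d := by
  rcases ha with ⟨h, h'⟩ | ⟨h, h'⟩
  · simp only [mem_Sset3_iff, not_forall, facetHeight_add] at h h'
    obtain ⟨i, hi⟩ := h'
    have := h i
    exact ⟨i, by omega, by omega, by omega⟩
  · simp only [mem_JMon3_iff, not_forall, facetHeight_add] at h h'
    obtain ⟨i, hi⟩ := h'
    have := h i
    exact ⟨i, by omega, by omega, by omega⟩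

lemma facetPoint_mem {d : ℤ × ℤ × ℤ} {i : Fin 4} {j u v : ℤ} (hd : facetHeight i d < 0)
    (hj : 0 ≤ j) (hjd : j ≤ -facetHeight i d) (hu : j < u) (hv : j < v) :
    facetPoint i j u v ∈ Omega3 d ∪ {a | a ∈ JMon3 ∧ a + d ∉ JMon3} := by
  have hpos (k : Fin 4) (hik : i ≠ k) : 0 < facetHeight k (facetPoint i j u v) :=
    lt_facetHeight_facetPoint hik hj le_rfl (by omega) (by omega)
  have hself := facetHeight_facetPoint_self i j u v
  rcases hj.eq_or_lt with rfl | hj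
  · refine Or.inl ⟨mem_Sset3_iff.2 fun k => ?_, fun h => ?_⟩
    · by_cases hik : i = k
      · subst hik; omega
      · exact (hpos k hik).le
    · have := mem_Sset3_iff.1 h i
      rw [facetHeight_add] at this
      omega
  · refine Or.inr ⟨mem_JMon3_iff.2 fun k => ?_, fun h => ?_⟩
    · by_cases hik : i = k
      · subst hik; omega
      · exact hpos k hik
    · have := mem_JMon3_iff.1 h i
      rw [facetHeight_add] at this
      omega

lemma vanishingIdeal_eq_span_prod (d : ℤ × ℤ × ℤ) :
    vanishingIdeal (Omega3 d ∪ {a | a ∈ JMon3 ∧ a + d ∉ JMon3}) =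
      Ideal.span {∏ i, if facetHeight i d < 0 then
        dfact (facetForm i) (-facetHeight i d) else 1} := by
  ext f
  rw [Ideal.mem_span_singleton]
  constructor
  · intro hf
    refine Finset.prod_dvd_of_isRelPrime (fun i _ k _ hik => ?_) fun i _ => ?_
    · dsimp only [Function.onFun]
      split_ifs
      · exact IsRelPrime.prod_left fun j _ => IsRelPrime.prod_right fun b _ =>
          isRelPrime_facetForm_sub_C (by simp [hik])
      all_goals simp [isRelPrime_one_left, isRelPrime_one_right]
    · split_ifs with hd
      · refine Finset.prod_dvd_of_isRelPrime
          (fun j _ b _ hjb => isRelPrime_facetForm_sub_C (by simp [hjb])) fun j hj => ?_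
        rw [Finset.mem_range] at hj
        have := facetForm_sub_C_dvd_of_eval_eq_zero i j f fun u v hu hv =>
          hf _ (facetPoint_mem hd (by omega) (by omega) hu hv)
        simpa using this
      · exact one_dvd f
  · rintro ⟨g, rfl⟩ a ha
    obtain ⟨i, hd, h0, hle⟩ := exists_facetHeight_of_mem ha
    rw [map_mul, map_prod, Finset.prod_eq_zero (Finset.mem_univ i), zero_mul]
    rw [if_pos hd, dfact, map_prod]
    refine Finset.prod_eq_zero (i := (facetHeight i a).toNat)
      (Finset.mem_range.2 (by omega)) ?_
    rw [map_sub, eval_facetForm, eval_C, sub_eq_zero]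
    exact_mod_cast (Int.toNat_of_nonneg h0).symm

/-- All graded pieces of the idealizer `II(J)` for `J = ⟨t₁²t₂t₃⟩`: the vanishing ideal of
`Ω(d) ∪ {a ∈ JMon : a + d ∉ JMon}` is principal, generated by
`∏_{i : h_i(d) < 0} (H_i, h_i(−d))!` where `H₁ = θ₃`, `H₂ = θ₂`, `H₃ = θ₁ − θ₃`,
`H₄ = θ₁ − θ₂` (empty product equal to `1`). -/
theorem statement13 (d : ℤ × ℤ × ℤ) :
    vanishingIdeal (Omega3 d ∪ {a | a ∈ JMon3 ∧ a + d ∉ JMon3}) =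
      Ideal.span
        {(if d.2.2 < 0 then dfact (X 2) (-d.2.2) else 1) *
          (if d.2.1 < 0 then dfact (X 1) (-d.2.1) else 1) *
          (if d.1 - d.2.2 < 0 then dfact (X 0 - X 2) (-(d.1 - d.2.2)) else 1) *
          (if d.1 - d.2.1 < 0 then dfact (X 0 - X 1) (-(d.1 - d.2.1)) else 1)} := by
  rw [vanishingIdeal_eq_span_prod, Fin.prod_univ_four]
  rfl

end
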